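/- arXiv:2112.10563 — 2 statements merged into one kernel-verified Lean document; each statement's English description precedes it below -/
import Mathlib

section
/- Let 1 < p ≤ 2 and assume that the Burkholder integrand B_p : ℝ^{2×2} → ℝ is quasiconvex at the identity matrix Id. Then every continuous, isotropic, rank-one convex, positively p-homogeneous integrand F : ℝ^{2×2} → [0,∞) is quasiconvex at every A ∈ CO(2). -/
open Matrix MeasureTheory Set

/-- The operator norm `|A| = max_{|ξ|=1} |Aξ|` of a square matrix, computed via the
Euclidean spaces. -/
noncomputable def opNorm {n : ℕ} (A : Matrix (Fin n) (Fin n) ℝ) : ℝ :=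
  ‖LinearMap.toContinuousLinearMap (Matrix.toEuclideanLin A)‖

/-- `F` is rank-one convex: `t ↦ F (A + t • X)` is convex whenever `rank X = 1`. -/
def RankOneConvex {n : ℕ} (F : Matrix (Fin n) (Fin n) ℝ → ℝ) : Prop :=
  ∀ A X : Matrix (Fin n) (Fin n) ℝ, X.rank = 1 →
    ConvexOn ℝ Set.univ (fun t : ℝ => F (A + t • X))

/-- `F` is isotropic: `F (Q * A * R) = F A` for all `Q, R ∈ SO(n)`. -/
def Isotropic {n : ℕ} (F : Matrix (Fin n) (Fin n) ℝ → ℝ) : Prop :=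
  ∀ (A Q R : Matrix (Fin n) (Fin n) ℝ),
    Qᵀ * Q = 1 → Q.det = 1 → Rᵀ * R = 1 → R.det = 1 → F (Q * A * R) = F A

/-- `F` is positively `p`-homogeneous: `F (t • A) = t ^ p * F A` for `t > 0`. -/
def PosHomogeneous {n : ℕ} (p : ℝ) (F : Matrix (Fin n) (Fin n) ℝ → ℝ) : Prop :=
  ∀ (A : Matrix (Fin n) (Fin n) ℝ) (t : ℝ), 0 < t → F (t • A) = t ^ p * F A

/-- The set `CO(n) = {t • Q : Q ∈ O(n), t ∈ ℝ}` of conformal matrices. -/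
def ConformalSet (n : ℕ) : Set (Matrix (Fin n) (Fin n) ℝ) :=
  {A | ∃ (t : ℝ) (Q : Matrix (Fin n) (Fin n) ℝ), Qᵀ * Q = 1 ∧ A = t • Q}

/-- The matrix `Īd = diag(1, …, 1, -1)`. -/
noncomputable def Ibar (n : ℕ) : Matrix (Fin n) (Fin n) ℝ :=
  Matrix.diagonal (fun i => if (i : ℕ) = n - 1 then -1 else 1)

/-- The Burkholder integrand `B_p(A) = (|1 - n/p| |A|^n + det A) |A|^(p-n)`, with
`B_p(0) = 0`. -/
noncomputable def Burk (n : ℕ) (p : ℝ) (A : Matrix (Fin n) (Fin n) ℝ) : ℝ :=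
  if A = 0 then 0
  else (|1 - (n : ℝ) / p| * opNorm A ^ (n : ℕ) + A.det) * opNorm A ^ (p - (n : ℝ))

/-- The matrix of the a.e. derivative of `φ` at `x`: entries `(Dφ)_{ij} = ∂_j φ_i` (junk
value where `φ` is not differentiable). -/
noncomputable def gradMat {n : ℕ} (φ : (Fin n → ℝ) → (Fin n → ℝ)) (x : Fin n → ℝ) :
    Matrix (Fin n) (Fin n) ℝ :=
  Matrix.of fun i j => fderiv ℝ φ x (Pi.single j 1) i

/-- `F` is quasiconvex at `A`: for every bounded open `Ω ⊂ ℝ²` and every Lipschitz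
`φ : ℝ² → ℝ²` vanishing outside `Ω` one has `F(A)·|Ω| ≤ ∫_Ω F(A + Dφ)`. -/
def QuasiconvexAt (F : Matrix (Fin 2) (Fin 2) ℝ → ℝ) (A : Matrix (Fin 2) (Fin 2) ℝ) : Prop :=
  ∀ (Ω : Set (Fin 2 → ℝ)), IsOpen Ω → Bornology.IsBounded Ω →
    ∀ (φ : (Fin 2 → ℝ) → (Fin 2 → ℝ)) (K : NNReal), LipschitzWith K φ →
      (∀ x ∉ Ω, φ x = 0) →
      F A * (volume Ω).toReal ≤ ∫ x in Ω, F (A + gradMat φ x)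

/-- A convex `f` with `f s = s ^ p * f s⁻¹` has `p / 2 * f 1` as a subgradient at `1`. -/
lemma ConvexOn.add_half_mul_sub_le {f : ℝ → ℝ} {p : ℝ} (hf : ConvexOn ℝ univ f)
    (hs : ∀ s, 0 < s → f s = s ^ p * f s⁻¹) {y : ℝ} (hy : y < 1) :
    f 1 + p / 2 * f 1 * (y - 1) ≤ f y := by
  set D := (f 1 - f y) / (1 - y) with hD
  have hfy : f y = f 1 - D * (1 - y) := by
    rw [hD, div_mul_cancel₀ _ (by linarith)]; ring
  have above : ∀ s, 1 < s → f 1 + D * (s - 1) ≤ f s := fun s h => by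
    have := hf.slope_mono_adjacent (mem_univ y) (mem_univ s) hy h
    rw [← hD, le_div_iff₀ (by linarith)] at this
    linarith
  have below : ∀ s, y < s → s < 1 → f s ≤ f 1 - D * (1 - s) := fun s h1 h2 => by
    have := hf.secant_mono (mem_univ 1) (mem_univ y) (mem_univ s) hy.ne h2.ne h1.le
    rw [← neg_div_neg_eq, ← neg_div_neg_eq (f s - f 1)] at this
    simp only [neg_sub] at this
    rw [← hD, le_div_iff₀ (by linarith)] at this
    linarith
  let g : ℝ → ℝ := fun s => s ^ p * (f 1 - D * (1 - s⁻¹)) - D * (s - 1)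
  have hg : HasDerivAt g (p * f 1 - D - D) 1 := by
    have h1 : HasDerivAt (fun s : ℝ => s ^ p) (p * (1 : ℝ) ^ (p - 1)) 1 :=
      Real.hasDerivAt_rpow_const (Or.inl one_ne_zero)
    have h2 : HasDerivAt (fun s : ℝ => s⁻¹) (-((1 : ℝ) ^ 2)⁻¹) 1 := hasDerivAt_inv one_ne_zero
    have h3 := (h1.mul (((h2.const_sub 1).const_mul D).const_sub (f 1))).sub
      (((hasDerivAt_id (1 : ℝ)).sub_const 1).const_mul D)
    refine h3.congr_deriv ?_
    simp
    ring
  have hmin : ∀ᶠ s in nhdsWithin (1 : ℝ) (Ioi 1), 0 ≤ slope g 1 s := by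
    have hcont : Filter.Tendsto (fun s : ℝ => s⁻¹) (nhds 1) (nhds 1) := by
      simpa using (continuousAt_inv₀ (one_ne_zero (α := ℝ))).tendsto
    filter_upwards [self_mem_nhdsWithin,
      nhdsWithin_le_nhds (hcont.eventually (lt_mem_nhds hy))] with s h1 h2
    have h1 : 1 < s := h1
    have hb := below s⁻¹ h2 (inv_lt_one_of_one_lt₀ h1)
    have hp := mul_le_mul_of_nonneg_left hb (Real.rpow_nonneg (by linarith : (0 : ℝ) ≤ s) p)
    rw [← hs s (by linarith)] at hp
    have ha := above s h1
    rw [slope_def_field]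
    apply div_nonneg _ (by linarith)
    simp only [g, Real.one_rpow, inv_one]
    linarith
  have hlim := (hasDerivAt_iff_tendsto_slope.1 hg).mono_left
    (nhdsWithin_mono 1 (fun s (h : s ∈ Ioi (1 : ℝ)) => (mem_Ioi.1 h).ne'))
  have h0 : 0 ≤ p * f 1 - D - D := ge_of_tendsto hlim hmin
  rw [hfy]
  nlinarith

lemma opNorm_nonneg {n : ℕ} (A : Matrix (Fin n) (Fin n) ℝ) : 0 ≤ opNorm A := norm_nonneg _

lemma sq_mulVec_le_opNorm (A : Matrix (Fin 2) (Fin 2) ℝ) (x y : ℝ) :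
    (A 0 0 * x + A 0 1 * y) ^ 2 + (A 1 0 * x + A 1 1 * y) ^ 2
      ≤ opNorm A ^ 2 * (x ^ 2 + y ^ 2) := by
  have h := (LinearMap.toContinuousLinearMap (Matrix.toEuclideanLin A)).le_opNorm !₂[x, y]
  have h2 := pow_le_pow_left₀ (norm_nonneg _) h 2
  rw [mul_pow, EuclideanSpace.norm_sq_eq, EuclideanSpace.norm_sq_eq] at h2
  simpa [opNorm, Fin.sum_univ_two, Matrix.toLpLin_apply, Matrix.mulVec, dotProduct] using h2

lemma exists_sq_mulVec_eq_opNorm (A : Matrix (Fin 2) (Fin 2) ℝ) :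
    ∃ x y : ℝ, x ^ 2 + y ^ 2 = 1 ∧
      (A 0 0 * x + A 0 1 * y) ^ 2 + (A 1 0 * x + A 1 1 * y) ^ 2 = opNorm A ^ 2 := by
  set T := LinearMap.toContinuousLinearMap (Matrix.toEuclideanLin A)
  obtain ⟨v, hv, hmax⟩ := (isCompact_sphere (0 : EuclideanSpace ℝ (Fin 2)) 1).exists_isMaxOn
    (NormedSpace.sphere_nonempty.2 zero_le_one) T.continuous.norm.continuousOn
  have hv1 : ‖v‖ = 1 := by simpa using hv
  have hT : opNorm A = ‖T v‖ := by
    refine le_antisymm (T.opNorm_le_of_unit_norm (norm_nonneg _) fun z hz => ?_) ?_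
    · exact hmax (by simpa using hz)
    · simpa [hv1, T, opNorm] using T.le_opNorm v
  refine ⟨v 0, v 1, ?_, ?_⟩
  · have := EuclideanSpace.norm_sq_eq v
    rw [hv1] at this
    simpa [Fin.sum_univ_two] using this.symm
  · rw [hT, EuclideanSpace.norm_sq_eq]
    simp [T, Fin.sum_univ_two, Matrix.toLpLin_apply]

/-- Singular value decomposition with rotations: `Q * A * R = diag(|A|, det A / |A|)`. -/
lemma exists_rotations_diagonalize (A : Matrix (Fin 2) (Fin 2) ℝ) (hm : 0 < opNorm A) :
    ∃ Q R : Matrix (Fin 2) (Fin 2) ℝ, Qᵀ * Q = 1 ∧ Q.det = 1 ∧ Rᵀ * R = 1 ∧ R.det = 1 ∧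
      Q * A * R = !![opNorm A, 0; 0, A.det / opNorm A] := by
  obtain ⟨v, w, hvw, hnorm⟩ := exists_sq_mulVec_eq_opNorm A
  have hle := sq_mulVec_le_opNorm A
  rw [Matrix.det_fin_two]
  generalize opNorm A = m at *
  obtain ⟨a, b, c, d, rfl⟩ : ∃ a b c d, A = !![a, b; c, d] :=
    ⟨A 0 0, A 0 1, A 1 0, A 1 1, Matrix.eta_fin_two A⟩
  simp only [Matrix.of_apply, Matrix.cons_val', Matrix.cons_val_zero, Matrix.cons_val_one,
    Matrix.cons_val_fin_one] at *
  have horth : (a * v + b * w) * (b * v - a * w) + (c * v + d * w) * (d * v - c * w) = 0 := by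
    set γ := (a * v + b * w) * (b * v - a * w) + (c * v + d * w) * (d * v - c * w) with hγ
    set K := m ^ 2 - ((b * v - a * w) ^ 2 + (d * v - c * w) ^ 2) with hK
    have key : ∀ s, 2 * s * γ ≤ s ^ 2 * K := fun s => by
      have := hle (v - s * w) (w + s * v)
      have e : (v - s * w) ^ 2 + (w + s * v) ^ 2 = 1 + s ^ 2 := by
        linear_combination (1 + s ^ 2) * hvw
      rw [e] at this
      rw [hγ, hK]
      linarith
    have hK0 : 0 ≤ K := by linarith [key 1, key (-1)]
    have h := key (γ / (K + 1))
    have e1 : 2 * (γ / (K + 1)) * γ = γ ^ 2 * (2 * (K + 1)) / (K + 1) ^ 2 := by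
      field_simp
    rw [e1, div_pow, div_mul_eq_mul_div, div_le_div_iff_of_pos_right (by positivity)] at h
    have : γ ^ 2 ≤ 0 := by nlinarith [mul_nonneg (sq_nonneg γ) hK0]
    exact pow_eq_zero_iff two_ne_zero |>.1 (le_antisymm this (sq_nonneg _))
  have hm0 := hm.ne'
  refine ⟨!![(a * v + b * w) / m, (c * v + d * w) / m; -((c * v + d * w) / m),
    (a * v + b * w) / m], !![v, -w; w, v], ?_, ?_, ?_, ?_, ?_⟩
  · ext i j
    fin_cases i <;> fin_cases j <;>
      simp [Matrix.mul_apply, Fin.sum_univ_two] <;> field_simp <;> linarith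
  · simp only [Matrix.det_fin_two_of]
    field_simp
    linarith
  · ext i j
    fin_cases i <;> fin_cases j <;> simp [Matrix.mul_apply, Fin.sum_univ_two] <;> linarith
  · simp only [Matrix.det_fin_two_of]
    linarith
  · ext i j
    fin_cases i <;> fin_cases j <;>
      simp [Matrix.mul_apply, Fin.sum_univ_two] <;> field_simp
    · linear_combination hnorm
    · linear_combination horth
    · ring
    · linear_combination (a * d - b * c) * hvw

/-- Up to normalization at the identity, the Burkholder integrand lies below every nonnegative,
isotropic, rank-one convex, `p`-homogeneous integrand. -/
lemma mul_burk_le {p : ℝ} (hp1 : 1 < p) (hp2 : p ≤ 2) {F : Matrix (Fin 2) (Fin 2) ℝ → ℝ}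
    (hF0 : ∀ A, 0 ≤ F A) (hiso : Isotropic F) (hrc : RankOneConvex F) (hhom : PosHomogeneous p F)
    (A : Matrix (Fin 2) (Fin 2) ℝ) : F 1 * (p / 2) * Burk 2 p A ≤ F A := by
  rcases eq_or_ne A 0 with rfl | hA
  · simpa [Burk] using hF0 0
  have hm : 0 < opNorm A := by
    refine (opNorm_nonneg A).lt_of_ne' fun h => hA ?_
    simpa [opNorm] using h
  obtain ⟨Q, R, hQ, hQd, hR, hRd, hd⟩ := exists_rotations_diagonalize A hm
  rw [← hiso A Q R hQ hQd hR hRd, hd]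
  set m := opNorm A with hmdef
  set y := A.det / m ^ 2 with hy
  let f : ℝ → ℝ := fun t => F !![1, 0; 0, t]
  have hf : ConvexOn ℝ univ f := by
    have hX : (!![0, 0; 0, 1] : Matrix (Fin 2) (Fin 2) ℝ).rank = 1 := by
      have : (!![0, 0; 0, 1] : Matrix (Fin 2) (Fin 2) ℝ) = Matrix.diagonal ![0, 1] := by
        ext i j; fin_cases i <;> fin_cases j <;> simp
      rw [this, Matrix.rank_diagonal, Fintype.card_eq_one_iff]
      refine ⟨⟨1, by simp⟩, fun ⟨i, hi⟩ => ?_⟩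
      fin_cases i
      · exact absurd rfl hi
      · rfl
    convert hrc !![1, 0; 0, 0] !![0, 0; 0, 1] hX using 2 with t
    simp only [f]
    congr 1
    ext i j; fin_cases i <;> fin_cases j <;> simp
  have hs : ∀ s, 0 < s → f s = s ^ p * f s⁻¹ := fun s h => by
    have hJ : (!![0, 1; -1, 0] : Matrix (Fin 2) (Fin 2) ℝ)ᵀ * !![0, 1; -1, 0] = 1 := by
      ext i j; fin_cases i <;> fin_cases j <;> simp [Matrix.mul_apply, Fin.sum_univ_two]
    have hJ' : (!![0, -1; 1, 0] : Matrix (Fin 2) (Fin 2) ℝ)ᵀ * !![0, -1; 1, 0] = 1 := by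
      ext i j; fin_cases i <;> fin_cases j <;> simp [Matrix.mul_apply, Fin.sum_univ_two]
    simp only [f]
    rw [← hhom _ s h, ← hiso _ _ _ hJ (by simp [Matrix.det_fin_two_of]) hJ'
      (by simp [Matrix.det_fin_two_of])]
    congr 1
    ext i j
    fin_cases i <;> fin_cases j <;> simp [Matrix.mul_apply, Fin.sum_univ_two, h.ne']
  have hf1 : f 1 = F 1 := by simp only [f, ← Matrix.one_fin_two]
  have hsub : f 1 + p / 2 * f 1 * (y - 1) ≤ f y := by
    have hsq : y ≤ 1 := by
      rw [hy, div_le_one (by positivity), Matrix.det_fin_two]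
      have h1 := sq_mulVec_le_opNorm A 1 0
      have h2 := sq_mulVec_le_opNorm A 0 1
      rw [← hmdef] at h1 h2
      nlinarith [sq_nonneg (A 0 0 - A 1 1), sq_nonneg (A 0 1 + A 1 0)]
    rcases hsq.lt_or_eq with h | h
    · exact hf.add_half_mul_sub_le hs h
    · simp [h]
  have hFd : F !![m, 0; 0, A.det / m] = m ^ p * f y := by
    simp only [f]
    rw [← hhom _ m hm]
    congr 1
    ext i j
    fin_cases i <;> fin_cases j <;> simp [hy]
    field_simp
  have hB : Burk 2 p A = m ^ p * (2 / p - 1 + y) := by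
    have hp : 1 ≤ 2 / p := (one_le_div (by linarith)).2 hp2
    rw [Burk, if_neg hA, ← hmdef, Real.rpow_sub hm]
    push_cast
    rw [abs_of_nonpos (by linarith), Real.rpow_two, hy]
    field_simp
    ring
  rw [hFd, hB]
  calc F 1 * (p / 2) * (m ^ p * (2 / p - 1 + y))
      = m ^ p * (f 1 + p / 2 * f 1 * (y - 1)) := by
        rw [hf1]
        field_simp
        ring
    _ ≤ m ^ p * f y := mul_le_mul_of_nonneg_left hsub (Real.rpow_nonneg hm.le p)

lemma measurable_gradMat {n : ℕ} (φ : (Fin n → ℝ) → (Fin n → ℝ)) :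
    Measurable fun (x : Fin n → ℝ) (i j : Fin n) => gradMat φ x i j := by
  refine measurable_pi_lambda _ fun i => measurable_pi_lambda _ fun j => ?_
  exact (measurable_pi_apply i).comp (measurable_fderiv_apply_const ℝ φ (Pi.single j 1))

lemma abs_gradMat_le {n : ℕ} {φ : (Fin n → ℝ) → (Fin n → ℝ)} {K : NNReal}
    (hφ : LipschitzWith K φ) (x : Fin n → ℝ) (i j : Fin n) : |gradMat φ x i j| ≤ K := by
  calc |gradMat φ x i j| ≤ ‖fderiv ℝ φ x (Pi.single j 1)‖ :=
        norm_le_pi_norm (fderiv ℝ φ x (Pi.single j 1)) i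
    _ ≤ ‖fderiv ℝ φ x‖ * ‖(Pi.single j 1 : Fin n → ℝ)‖ := ContinuousLinearMap.le_opNorm _ _
    _ ≤ K := by
        rw [Pi.norm_single, norm_one, mul_one]
        exact norm_fderiv_le_of_lipschitz ℝ hφ

lemma integrableOn_comp_gradMat {n : ℕ} {F : Matrix (Fin n) (Fin n) ℝ → ℝ} (hF : Continuous F)
    (A : Matrix (Fin n) (Fin n) ℝ) {Ω : Set (Fin n → ℝ)} (hΩ : Bornology.IsBounded Ω)
    {φ : (Fin n → ℝ) → (Fin n → ℝ)} {K : NNReal} (hφ : LipschitzWith K φ) :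
    IntegrableOn (fun x => F (A + gradMat φ x)) Ω := by
  have hc : IsCompact (Set.pi univ fun _ : Fin n => Set.pi univ fun _ : Fin n =>
      Icc (-(K : ℝ)) K) :=
    isCompact_univ_pi fun _ => isCompact_univ_pi fun _ => isCompact_Icc
  have hG : Continuous fun M : Fin n → Fin n → ℝ => F (A + Matrix.of M) :=
    hF.comp (continuous_const.add continuous_id)
  obtain ⟨C, hC⟩ := hc.exists_bound_of_continuousOn hG.continuousOn
  refine Measure.integrableOn_of_bounded (M := C) hΩ.measure_lt_top.ne ?_ ?_
  · exact (hG.measurable.comp (measurable_gradMat φ)).aestronglyMeasurable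
  · exact Filter.Eventually.of_forall fun x =>
      hC _ fun i _ j _ => abs_le.1 (abs_gradMat_le hφ x i j)

lemma quasiconvexAt_one {p : ℝ} (hp1 : 1 < p) (hp2 : p ≤ 2)
    (hBp : QuasiconvexAt (Burk 2 p) 1) {F : Matrix (Fin 2) (Fin 2) ℝ → ℝ}
    (hFc : Continuous F) (hF0 : ∀ A, 0 ≤ F A) (hiso : Isotropic F)
    (hrc : RankOneConvex F) (hhom : PosHomogeneous p F) : QuasiconvexAt F 1 := by
  intro Ω hΩ hb φ K hφ h0
  have hop : opNorm (1 : Matrix (Fin 2) (Fin 2) ℝ) = 1 := by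
    have : LinearMap.toContinuousLinearMap (Matrix.toEuclideanLin (1 : Matrix (Fin 2) (Fin 2) ℝ))
        = ContinuousLinearMap.id ℝ (EuclideanSpace ℝ (Fin 2)) := by
      ext; simp
    rw [opNorm, this, ContinuousLinearMap.norm_id]
  have hB1 : F 1 * (p / 2) * Burk 2 p 1 = F 1 := by
    have hp : 1 ≤ 2 / p := (one_le_div (by linarith)).2 hp2
    rw [Burk, if_neg one_ne_zero, hop]
    push_cast
    rw [abs_of_nonpos (by linarith), Matrix.det_one, Real.one_rpow]
    field_simp
    ring
  have hc : 0 ≤ F 1 * (p / 2) := mul_nonneg (hF0 1) (by linarith)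
  calc F 1 * (volume Ω).toReal
      = F 1 * (p / 2) * (Burk 2 p 1 * (volume Ω).toReal) := by
        rw [← mul_assoc, hB1]
    _ ≤ F 1 * (p / 2) * ∫ x in Ω, Burk 2 p (1 + gradMat φ x) :=
        mul_le_mul_of_nonneg_left (hBp Ω hΩ hb φ K hφ h0) hc
    _ = ∫ x in Ω, F 1 * (p / 2) * Burk 2 p (1 + gradMat φ x) := (integral_const_mul _ _).symm
    _ ≤ ∫ x in Ω, F (1 + gradMat φ x) := by
        by_cases hi : IntegrableOn (fun x => F 1 * (p / 2) * Burk 2 p (1 + gradMat φ x)) Ω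
        · exact integral_mono hi (integrableOn_comp_gradMat hFc 1 hb hφ)
            fun x => mul_burk_le hp1 hp2 hF0 hiso hrc hhom _
        · rw [integral_undef hi]
          exact integral_nonneg fun x => hF0 _

lemma gradMat_mulVec {n : ℕ} (M : Matrix (Fin n) (Fin n) ℝ) {φ : (Fin n → ℝ) → (Fin n → ℝ)}
    {x : Fin n → ℝ} (hφ : DifferentiableAt ℝ φ x) :
    gradMat (fun z => M *ᵥ φ z) x = M * gradMat φ x := by
  have h : HasFDerivAt (fun z => M *ᵥ φ z)
      ((LinearMap.toContinuousLinearMap (Matrix.mulVecLin M)).comp (fderiv ℝ φ x)) x :=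
    (LinearMap.toContinuousLinearMap (Matrix.mulVecLin M)).hasFDerivAt.comp x hφ.hasFDerivAt
  ext i j
  simp [gradMat, h.fderiv, Matrix.mul_apply, Matrix.mulVec, dotProduct]

lemma quasiconvexAt_of_comp_mul {F : Matrix (Fin 2) (Fin 2) ℝ → ℝ}
    {M N : Matrix (Fin 2) (Fin 2) ℝ} (hMN : M * N = 1)
    (h : QuasiconvexAt (fun A => F (M * A)) 1) : QuasiconvexAt F M := by
  intro Ω hΩ hb φ K hφ h0
  have key := h Ω hΩ hb (fun z => N *ᵥ φ z) _
    ((LinearMap.toContinuousLinearMap (Matrix.mulVecLin N)).lipschitz.comp hφ)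
    (fun x hx => by simp [h0 x hx])
  beta_reduce at key
  rw [mul_one] at key
  refine key.trans_eq (integral_congr_ae ?_)
  filter_upwards [ae_restrict_of_ae hφ.ae_differentiableAt] with x hx
  rw [gradMat_mulVec N hx, mul_add, ← mul_assoc, hMN, mul_one, one_mul]

/-- Let `1 < p ≤ 2` and assume the Burkholder integrand `B_p` is
quasiconvex at `Id`. Then every continuous, isotropic, rank-one convex, positively
`p`-homogeneous `F : ℝ^{2×2} → [0,∞)` is quasiconvex at every conformal matrix. -/
theorem stmt_2 (p : ℝ) (hp1 : 1 < p) (hp2 : p ≤ 2)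
    (hBp : QuasiconvexAt (Burk 2 p) 1)
    (F : Matrix (Fin 2) (Fin 2) ℝ → ℝ)
    (hFc : Continuous F) (hF0 : ∀ A, 0 ≤ F A) (hiso : Isotropic F)
    (hrc : RankOneConvex F) (hhom : PosHomogeneous p F) :
    ∀ A ∈ ConformalSet 2, QuasiconvexAt F A := by
  rintro _ ⟨t, Q, hQ, rfl⟩
  rcases eq_or_ne t 0 with rfl | ht
  · intro Ω _ _ φ _ _ _
    have hzero : F 0 = 0 := by
      have h := hhom 0 2 two_pos
      rw [smul_zero] at h
      have : (1 : ℝ) < 2 ^ p := Real.one_lt_rpow one_lt_two (by linarith)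
      nlinarith [hF0 0]
    rw [zero_smul, hzero, zero_mul]
    exact integral_nonneg fun x => hF0 _
  have hQ' : Q * Qᵀ = 1 := mul_eq_one_comm.1 hQ
  refine quasiconvexAt_of_comp_mul (N := t⁻¹ • Qᵀ) (by simp [hQ', ht]) ?_
  refine quasiconvexAt_one hp1 hp2 hBp (hFc.comp (continuous_const.mul continuous_id))
    (fun A => hF0 _) ?_ ?_ ?_
  · intro A R S hR hRd hS hSd
    have hdet : Q.det * Q.det = 1 := by simpa using congrArg Matrix.det hQ
    beta_reduce
    rw [← hiso (t • Q * A) (Q * R * Qᵀ) S _ _ hS hSd]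
    · congr 1
      simp only [Matrix.mul_assoc, Matrix.smul_mul, Matrix.mul_smul]
      rw [← Matrix.mul_assoc Qᵀ Q, hQ, Matrix.one_mul]
    · simp only [Matrix.transpose_mul, Matrix.transpose_transpose, Matrix.mul_assoc]
      rw [← Matrix.mul_assoc Qᵀ Q, hQ, Matrix.one_mul, ← Matrix.mul_assoc Rᵀ, hR,
        Matrix.one_mul, hQ']
    · rw [Matrix.det_mul, Matrix.det_mul, Matrix.det_transpose, hRd, mul_one, hdet]
  · intro A X hX
    have hunit : IsUnit (t • Q).det := by
      rw [← Matrix.isUnit_iff_isUnit_det]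
      exact IsUnit.of_mul_eq_one (t⁻¹ • Qᵀ) (by simp [hQ', ht])
    have := hrc (t • Q * A) (t • Q * X)
      (by rw [Matrix.rank_mul_eq_right_of_isUnit_det _ _ hunit, hX])
    simpa only [Matrix.mul_add, Matrix.mul_smul] using this
  · intro A s hs
    simp only [Matrix.mul_smul]
    exact hhom _ s hs
end

section
/- (Monotonicity) Let F : ℝ^{n×n} → ℝ be continuous, rank-one convex and isotropic. If A, B ∈ ℝ^{n×n} satisfy ∏_{i=1}^k λ_i(A) ≤ ∏_{i=1}^k λ_i(B) for every k = 1,…,n−1 and ∏_{i=1}^n λ_i(A) = ∏_{i=1}^n λ_i(B), then F(A) ≤ F(B). -/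
open Matrix MeasureTheory Set

/-- `lam` is the vector of signed singular values of `A`: they are decreasing with
`λ₁ ≥ … ≥ λ_{n-1} ≥ |λ_n|`, and `A = Q * diagonal lam * R` for some `Q, R ∈ SO(n)`
(so that `λ₁, …, λ_{n-1}, |λ_n|` are the eigenvalues of `√(AᵀA)` and
`sign λ_n = sign (det A)`). -/
def IsSignedSVD {n : ℕ} (A : Matrix (Fin n) (Fin n) ℝ) (lam : Fin n → ℝ) : Prop :=
  (∀ i j : Fin n, i < j → |lam j| ≤ lam i) ∧
  ∃ Q R : Matrix (Fin n) (Fin n) ℝ,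
    Qᵀ * Q = 1 ∧ Q.det = 1 ∧ Rᵀ * R = 1 ∧ R.det = 1 ∧
    A = Q * Matrix.diagonal lam * R

/-- If `|b'| ≤ |a| ≤ |a'|` and `a * b = a' * b'`, then `diag (a', b')` can be rotated on both sides
into an upper triangular matrix with diagonal `(a, b)`. -/
lemma exists_rotations_triangular {a b a' b' : ℝ} (h₁ : |b'| ≤ |a|) (h₂ : |a| ≤ |a'|)
    (h : a * b = a' * b') (h0 : a = 0 → b = 0) :
    ∃ c s p q : ℝ, c ^ 2 + s ^ 2 = 1 ∧ p ^ 2 + q ^ 2 = 1 ∧ c * a' * p - s * b' * q = a ∧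
      s * a' * p + c * b' * q = 0 ∧ -s * a' * q + c * b' * p = b := by
  have h₁' := sq_le_sq.mpr h₁
  have h₂' := sq_le_sq.mpr h₂
  obtain ⟨p, q, hpq, hv⟩ : ∃ p q : ℝ, p ^ 2 + q ^ 2 = 1 ∧
      a' ^ 2 * p ^ 2 + b' ^ 2 * q ^ 2 = a ^ 2 := by
    rcases eq_or_lt_of_le (h₁'.trans h₂') with he | hlt
    · exact ⟨1, 0, by norm_num, by linarith⟩
    · have hd : 0 < a' ^ 2 - b' ^ 2 := by linarith
      refine ⟨√((a ^ 2 - b' ^ 2) / (a' ^ 2 - b' ^ 2)),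
        √((a' ^ 2 - a ^ 2) / (a' ^ 2 - b' ^ 2)), ?_, ?_⟩ <;>
      rw [Real.sq_sqrt (div_nonneg (by linarith) hd.le),
        Real.sq_sqrt (div_nonneg (by linarith) hd.le)] <;> field_simp <;> ring
  by_cases ha : a = 0
  · have hb := h0 ha
    subst ha hb
    have hb' : b' = 0 := by simpa using h₁
    subst hb'
    have hp : a' * p = 0 := by
      have : (a' * p) ^ 2 = 0 := by linarith
      simpa using this
    exact ⟨1, 0, p, q, by norm_num, hpq, by linarith, by ring, by ring⟩
  · refine ⟨a' * p / a, -(b' * q / a), p, q, ?_, hpq, ?_, ?_, ?_⟩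
    · field_simp; linarith
    · field_simp; linarith
    · field_simp; ring
    · field_simp
      linear_combination (a' * b') * hpq - h

lemma rank_eq_one_of_le_of_ne_zero {m : ℕ} {X : Matrix (Fin m) (Fin m) ℝ} (h : X.rank ≤ 1)
    (hX : X ≠ 0) : X.rank = 1 := by
  have : X.rank ≠ 0 := fun h0 => hX <| by
    rw [Matrix.rank, Submodule.finrank_eq_zero, LinearMap.range_eq_bot] at h0
    exact Matrix.ext_of_mulVec_single fun i => by
      rw [Matrix.zero_mulVec]
      exact LinearMap.congr_fun h0 (Pi.single i 1)
  omega

/-- The two-dimensional monotonicity: passing to a diagonal matrix with the same determinant and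
closer entries decreases an isotropic rank-one convex function. -/
lemma RankOneConvex.apply_diag_two_le {f : Matrix (Fin 2) (Fin 2) ℝ → ℝ} (hrc : RankOneConvex f)
    (hiso : Isotropic f) {a b a' b' : ℝ} (h₁ : |b'| ≤ |a|) (h₂ : |a| ≤ |a'|)
    (h : a * b = a' * b') (h0 : a = 0 → b = 0) :
    f !![a, 0; 0, b] ≤ f !![a', 0; 0, b'] := by
  obtain ⟨c, s, p, q, hcs, hpq, e₁, e₂, e₃⟩ := exists_rotations_triangular h₁ h₂ h h0
  set t : ℝ := -c * a' * q - s * b' * p with ht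
  have hrot (x y : ℝ) (hxy : x ^ 2 + y ^ 2 = 1) :
      (!![x, -y; y, x])ᵀ * !![x, -y; y, x] = 1 ∧ (!![x, -y; y, x]).det = 1 := by
    constructor
    · ext i j
      fin_cases i <;> fin_cases j <;> simp [Matrix.mul_apply, Fin.sum_univ_two] <;>
        linarith
    · simp [Matrix.det_fin_two]; linarith
  have hs (c s p q t : ℝ) (hcs : c ^ 2 + s ^ 2 = 1) (hpq : p ^ 2 + q ^ 2 = 1)
      (e₁ : c * a' * p - s * b' * q = a) (e₂ : s * a' * p + c * b' * q = 0)
      (e₃ : -s * a' * q + c * b' * p = b) (ht : t = -c * a' * q - s * b' * p) :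
      f (!![a, 0; 0, b] + t • !![0, 1; 0, 0]) = f !![a', 0; 0, b'] := by
    rw [← hiso !![a', 0; 0, b'] !![c, -s; s, c] !![p, -q; q, p] (hrot c s hcs).1 (hrot c s hcs).2
      (hrot p q hpq).1 (hrot p q hpq).2]
    congr 1
    ext i j
    fin_cases i <;> fin_cases j <;> simp [Matrix.mul_apply, Fin.sum_univ_two] <;> linarith
  have hX : (!![0, 1; 0, 0] : Matrix (Fin 2) (Fin 2) ℝ).rank = 1 := by
    apply rank_eq_one_of_le_of_ne_zero
    · have : (!![0, 1; 0, 0] : Matrix (Fin 2) (Fin 2) ℝ) = vecMulVec ![1, 0] ![0, 1] := by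
        ext i j
        fin_cases i <;> fin_cases j <;> simp [vecMulVec]
      rw [this]
      exact rank_vecMulVec_le _ _
    · intro hX
      simpa using congrFun (congrFun hX 0) 1
  have hp := hs c s p q t hcs hpq e₁ e₂ e₃ ht
  have hm := hs c (-s) p (-q) (-t) (by linarith) (by linarith) (by linarith) (by linarith)
    (by linarith) (by rw [ht]; ring)
  have hc := (hrc !![a, 0; 0, b] _ hX).2 (mem_univ t) (mem_univ (-t))
    (show (0 : ℝ) ≤ 1 / 2 by norm_num) (show (0 : ℝ) ≤ 1 / 2 by norm_num) (by norm_num)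
  simp only [smul_eq_mul, hp, hm] at hc
  rw [show (1 : ℝ) / 2 * t + 1 / 2 * -t = 0 by ring, zero_smul, add_zero] at hc
  linarith

/-- The inclusion of the `(i, j)` coordinate plane, as a matrix. -/
noncomputable def planeIncl {n : ℕ} (i j : Fin n) : Matrix (Fin n) (Fin 2) ℝ :=
  Matrix.of fun p => ![if p = i then 1 else 0, if p = j then 1 else 0]

/-- The `n × n` matrix acting as `R` on the `(i, j)` plane and trivially on its complement. -/
noncomputable def planeExt {n : ℕ} (i j : Fin n) (R : Matrix (Fin 2) (Fin 2) ℝ) :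
    Matrix (Fin n) (Fin n) ℝ :=
  1 + planeIncl i j * (R - 1) * (planeIncl i j)ᵀ

section Plane

variable {n : ℕ} {i j : Fin n}

@[simp]
lemma planeIncl_apply_zero (p : Fin n) : planeIncl i j p 0 = if p = i then 1 else 0 := rfl

@[simp]
lemma planeIncl_apply_one (p : Fin n) : planeIncl i j p 1 = if p = j then 1 else 0 := rfl

lemma planeIncl_transpose_mul_self (hij : i ≠ j) : (planeIncl i j)ᵀ * planeIncl i j = 1 := by
  ext p q
  fin_cases p <;> fin_cases q <;>
    simp [Matrix.mul_apply, hij, hij.symm]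

lemma planeExt_transpose (R : Matrix (Fin 2) (Fin 2) ℝ) :
    (planeExt i j R)ᵀ = planeExt i j Rᵀ := by
  simp [planeExt, Matrix.mul_assoc]

lemma planeExt_mul_planeIncl (hij : i ≠ j) (R : Matrix (Fin 2) (Fin 2) ℝ) :
    planeExt i j R * planeIncl i j = planeIncl i j * R := by
  rw [planeExt, Matrix.add_mul, Matrix.mul_assoc _ _ (planeIncl i j),
    planeIncl_transpose_mul_self hij]
  simp [Matrix.mul_sub]

lemma planeIncl_transpose_mul_planeExt (hij : i ≠ j) (R : Matrix (Fin 2) (Fin 2) ℝ) :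
    (planeIncl i j)ᵀ * planeExt i j R = R * (planeIncl i j)ᵀ := by
  have := congrArg Matrix.transpose (planeExt_mul_planeIncl hij Rᵀ)
  simpa [planeExt_transpose] using this

lemma planeExt_transpose_mul_self (hij : i ≠ j) {R : Matrix (Fin 2) (Fin 2) ℝ} (hR : Rᵀ * R = 1) :
    (planeExt i j R)ᵀ * planeExt i j R = 1 := by
  rw [planeExt_transpose]
  nth_rw 2 [planeExt]
  rw [Matrix.mul_add, Matrix.mul_assoc (planeIncl i j), ← Matrix.mul_assoc (planeExt i j Rᵀ),
    planeExt_mul_planeIncl hij, planeExt, Matrix.mul_one, Matrix.mul_assoc (planeIncl i j),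
    Matrix.mul_assoc (planeIncl i j), add_assoc, ← Matrix.mul_add, ← Matrix.mul_assoc Rᵀ,
    ← Matrix.add_mul, Matrix.mul_sub, hR]
  simp

lemma det_planeExt (hij : i ≠ j) (R : Matrix (Fin 2) (Fin 2) ℝ) :
    (planeExt i j R).det = R.det := by
  rw [planeExt, Matrix.mul_assoc, Matrix.det_one_add_mul_comm, Matrix.mul_assoc,
    planeIncl_transpose_mul_self hij]
  simp

lemma planeExt_mul_of_disjoint (R : Matrix (Fin 2) (Fin 2) ℝ) {D : Matrix (Fin n) (Fin n) ℝ}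
    (hD : (planeIncl i j)ᵀ * D = 0) : planeExt i j R * D = D := by
  rw [planeExt, Matrix.add_mul, Matrix.mul_assoc _ _ D, hD]
  simp

lemma mul_planeExt_of_disjoint (R : Matrix (Fin 2) (Fin 2) ℝ) {D : Matrix (Fin n) (Fin n) ℝ}
    (hD : D * planeIncl i j = 0) : D * planeExt i j R = D := by
  rw [planeExt, Matrix.mul_add, Matrix.mul_assoc, ← Matrix.mul_assoc D, hD]
  simp

/-- The restriction of an isotropic function to a coordinate plane is isotropic. -/
lemma Isotropic.comp_plane {F : Matrix (Fin n) (Fin n) ℝ → ℝ} (hiso : Isotropic F) (hij : i ≠ j)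
    {D : Matrix (Fin n) (Fin n) ℝ} (hD : (planeIncl i j)ᵀ * D = 0) (hD' : D * planeIncl i j = 0) :
    Isotropic fun X : Matrix (Fin 2) (Fin 2) ℝ => F (D + planeIncl i j * X * (planeIncl i j)ᵀ) := by
  intro X Q R hQ hQd hR hRd
  dsimp only
  rw [← hiso (D + planeIncl i j * X * (planeIncl i j)ᵀ) (planeExt i j Q) (planeExt i j R)
    (planeExt_transpose_mul_self hij hQ) (by rw [det_planeExt hij, hQd])
    (planeExt_transpose_mul_self hij hR) (by rw [det_planeExt hij, hRd])]
  rw [Matrix.mul_add, Matrix.add_mul, planeExt_mul_of_disjoint _ hD,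
    mul_planeExt_of_disjoint _ hD', ← Matrix.mul_assoc (planeExt i j Q),
    ← Matrix.mul_assoc (planeExt i j Q), planeExt_mul_planeIncl hij, Matrix.mul_assoc _ _
    (planeExt i j R), planeIncl_transpose_mul_planeExt hij]
  simp only [Matrix.mul_assoc]

/-- The restriction of a rank-one convex function to a coordinate plane is rank-one convex. -/
lemma RankOneConvex.comp_plane {F : Matrix (Fin n) (Fin n) ℝ → ℝ} (hrc : RankOneConvex F)
    (hij : i ≠ j) (D : Matrix (Fin n) (Fin n) ℝ) :
    RankOneConvex fun X : Matrix (Fin 2) (Fin 2) ℝ =>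
      F (D + planeIncl i j * X * (planeIncl i j)ᵀ) := by
  intro A X hX
  have hr : (planeIncl i j * X * (planeIncl i j)ᵀ).rank = 1 := by
    apply rank_eq_one_of_le_of_ne_zero
    · exact ((rank_mul_le_left _ _).trans (rank_mul_le_right _ _)).trans hX.le
    · intro h0
      have : X = (planeIncl i j)ᵀ * (planeIncl i j * X * (planeIncl i j)ᵀ) * planeIncl i j := by
        rw [Matrix.mul_assoc (planeIncl i j), ← Matrix.mul_assoc, planeIncl_transpose_mul_self hij,
          Matrix.one_mul, Matrix.mul_assoc, planeIncl_transpose_mul_self hij, Matrix.mul_one]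
      rw [h0] at this
      simp [this] at hX
  convert hrc (D + planeIncl i j * A * (planeIncl i j)ᵀ) _ hr using 3 with t
  rw [Matrix.mul_add, Matrix.add_mul, add_assoc]
  simp

lemma diagonal_eq_add_plane (hij : i ≠ j) (w : Fin n → ℝ) (a b : ℝ) :
    diagonal (Function.update (Function.update w i a) j b) =
      diagonal (Function.update (Function.update w i 0) j 0) +
        planeIncl i j * !![a, 0; 0, b] * (planeIncl i j)ᵀ := by
  ext p q
  by_cases hpj : p = j <;> by_cases hpi : p = i <;> by_cases hpq : p = q <;>
    by_cases hqj : q = j <;> by_cases hqi : q = i <;>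
    simp_all [Matrix.mul_apply, Fin.sum_univ_two]

/-- Replacing two diagonal entries by closer ones with the same product decreases `F`. -/
lemma RankOneConvex.apply_diagonal_update_le {F : Matrix (Fin n) (Fin n) ℝ → ℝ}
    (hrc : RankOneConvex F) (hiso : Isotropic F) (hij : i ≠ j) (w : Fin n → ℝ) {a b : ℝ}
    (h₁ : |w j| ≤ |a|) (h₂ : |a| ≤ |w i|) (h : a * b = w i * w j) (h0 : a = 0 → b = 0) :
    F (diagonal (Function.update (Function.update w i a) j b)) ≤ F (diagonal w) := by
  have hw := diagonal_eq_add_plane hij w (w i) (w j)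
  rw [Function.update_eq_self, Function.update_eq_self] at hw
  rw [diagonal_eq_add_plane hij w a b, hw]
  refine (hrc.comp_plane hij _).apply_diag_two_le (hiso.comp_plane hij ?_ ?_) h₁ h₂ h h0
  · ext p q
    fin_cases p <;> simp [Matrix.mul_apply, Matrix.diagonal_apply, Function.update_apply] <;>
      grind
  · ext p q
    fin_cases q <;> simp [Matrix.mul_apply, Matrix.diagonal_apply, Function.update_apply] <;>
      grind

end Plane

lemma prod_update_update {n : ℕ} {i j : Fin n} (hij : i ≠ j) (y : Fin n → ℝ) {a b : ℝ}
    (h : a * b = y i * y j) {s : Finset (Fin n)} (hi : i ∈ s) (hj : j ∈ s) :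
    ∏ l ∈ s, Function.update (Function.update y i a) j b l = ∏ l ∈ s, y l := by
  have hi' : i ∈ s.erase j := Finset.mem_erase.mpr ⟨hij, hi⟩
  rw [← Finset.mul_prod_erase _ _ hj, ← Finset.mul_prod_erase _ _ hj,
    ← Finset.mul_prod_erase _ _ hi', ← Finset.mul_prod_erase _ y hi']
  have : ∏ l ∈ (s.erase j).erase i, Function.update (Function.update y i a) j b l =
      ∏ l ∈ (s.erase j).erase i, y l := by
    refine Finset.prod_congr rfl fun l hl => ?_
    simp only [Finset.mem_erase] at hl
    simp [hl.1, hl.2.1]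
  rw [this]
  simp only [Function.update_self, Function.update_of_ne hij]
  linear_combination h * ∏ l ∈ (s.erase j).erase i, y l

/-- A function that decreases under every multiplicative transfer between two coordinates is
monotone with respect to log-majorization of nonnegative vectors. -/
lemma le_of_log_majorized {n : ℕ} (G : (Fin n → ℝ) → ℝ)
    (hG : ∀ (z : Fin n → ℝ) (i j : Fin n) (a b : ℝ), (∀ l, 0 ≤ z l) → i ≠ j → z j ≤ a → a ≤ z i →
      a * b = z i * z j → (a = 0 → b = 0) →
      G (Function.update (Function.update z i a) j b) ≤ G z)
    (x : Fin n → ℝ) (hx0 : ∀ i, 0 ≤ x i) (hx : Antitone x) (y : Fin n → ℝ) (hy0 : ∀ i, 0 ≤ y i)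
    (hk : ∀ k : ℕ, ∏ i ∈ Finset.univ.filter (fun i : Fin n => (i : ℕ) < k), x i ≤
      ∏ i ∈ Finset.univ.filter (fun i : Fin n => (i : ℕ) < k), y i)
    (htot : ∏ i, x i = ∏ i, y i) : G x ≤ G y := by
  induction hN : (Finset.univ.filter fun i => x i ≠ y i).card using Nat.strong_induction_on
    generalizing y with
  | _ N ih =>
  by_cases hxy : x = y
  · rw [hxy]
  by_cases hex : ∃ k, y k < x k
  · classical
    obtain ⟨k, hkx, hkmin⟩ : ∃ k, y k < x k ∧ ∀ i < k, x i ≤ y i := by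
      obtain ⟨k, hk, hmin⟩ := WellFounded.has_min (wellFounded_lt (α := Fin n))
        {k | y k < x k} hex
      exact ⟨k, hk, fun i hi => not_lt.mp fun h => hmin i h hi⟩
    have hxpos : ∀ i ≤ k, 0 < x i := fun i hi => ((hy0 k).trans_lt hkx).trans_le (hx hi)
    have hpre := hk (k + 1)
    have hins : (Finset.univ.filter fun i : Fin n => (i : ℕ) < k + 1) =
        insert k (Finset.univ.filter fun i : Fin n => (i : ℕ) < k) := by
      ext i; simp [Fin.ext_iff]; omega
    rw [hins, Finset.prod_insert (by simp), Finset.prod_insert (by simp)] at hpre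
    have hPx : 0 < ∏ i ∈ Finset.univ.filter (fun i : Fin n => (i : ℕ) < k), x i :=
      Finset.prod_pos fun i hi => hxpos i (Fin.le_def.mpr (by simp at hi; omega))
    have hyk : 0 < y k := by
      refine (hy0 k).lt_of_ne fun h => ?_
      rw [← h, zero_mul] at hpre
      exact absurd hpre (not_le.mpr (mul_pos (hxpos k le_rfl) hPx))
    obtain ⟨j, hjk, hjy⟩ : ∃ j < k, x j < y j := by
      by_contra! hcon
      have : ∏ i ∈ Finset.univ.filter (fun i : Fin n => (i : ℕ) < k), x i =
          ∏ i ∈ Finset.univ.filter (fun i : Fin n => (i : ℕ) < k), y i :=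
        Finset.prod_congr rfl fun i hi => by
          have : i < k := by simpa using hi
          exact le_antisymm (hkmin i this) (hcon i this)
      rw [← this] at hpre
      exact absurd (le_of_mul_le_mul_right hpre hPx) (not_le.mpr hkx)
    have hxj := hxpos j hjk.le
    have hxjk : x k ≤ x j := hx hjk.le
    obtain ⟨a, b, hab, haj, haj', hbk, hbk', hor⟩ : ∃ a b, a * b = y j * y k ∧ x j ≤ a ∧ a ≤ y j ∧
        y k ≤ b ∧ b ≤ x k ∧ (a = x j ∨ b = x k) := by
      have hxk := hxpos k le_rfl
      rcases le_total (y j * y k) (x j * x k) with h | h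
      · refine ⟨x j, y j * y k / x j, by field_simp, le_rfl, hjy.le, ?_, ?_, .inl rfl⟩
        · rw [le_div_iff₀ hxj]; nlinarith
        · rw [div_le_iff₀ hxj]; linarith
      · refine ⟨y j * y k / x k, x k, by field_simp, ?_, ?_, hkx.le, le_rfl, .inr rfl⟩
        · rw [le_div_iff₀ hxk]; linarith
        · rw [div_le_iff₀ hxk]; nlinarith
    have hne : j ≠ k := hjk.ne
    refine le_trans ?_ (hG y j k a b hy0 hne (by linarith) haj' hab (fun h => by linarith))
    refine ih _ ?_ _ ?_ ?_ ?_ rfl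
    · rw [← hN]
      apply Finset.card_lt_card
      rw [Finset.ssubset_iff_of_subset]
      · rcases hor with h | h
        · exact ⟨j, by simp [hjy.ne], by simp [hne, h]⟩
        · exact ⟨k, by simp [hkx.ne'], by simp [h]⟩
      · intro i
        simp only [Finset.mem_filter, Finset.mem_univ, true_and, Function.update_apply]
        intro h h'
        split_ifs at h with h1 h2
        · subst h1; linarith
        · subst h2; linarith
        · exact h h'
    · intro i
      simp only [Function.update_apply]
      split_ifs
      · linarith
      · linarith
      · exact hy0 i
    · intro m
      by_cases hm : (k : ℕ) < m
      · rw [prod_update_update hne y hab (by simp; have := Fin.lt_def.mp hjk; omega) (by simpa)]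
        exact hk m
      · refine Finset.prod_le_prod (fun i _ => hx0 i) fun i hi => ?_
        have hik : i < k := by simp at hi; exact Fin.lt_def.mpr (by omega)
        rw [Function.update_of_ne hik.ne, Function.update_apply]
        split_ifs with h
        · exact h ▸ haj
        · exact hkmin i hik
    · rw [prod_update_update hne y hab (Finset.mem_univ _) (Finset.mem_univ _), htot]
  · push Not at hex
    obtain ⟨j, hj⟩ : ∃ j, x j < y j := by
      by_contra! hcon
      exact hxy (funext fun i => le_antisymm (hex i) (hcon i))
    obtain ⟨i, hi⟩ : ∃ i, y i = 0 := by
      by_contra! hcon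
      have hP : 0 < ∏ i, x i := htot ▸ Finset.prod_pos fun i _ => (hy0 i).lt_of_ne' (hcon i)
      have hxpos : ∀ i, 0 < x i := fun i => (hx0 i).lt_of_ne'
        (Finset.prod_ne_zero_iff.mp hP.ne' i (Finset.mem_univ i))
      exact (Finset.prod_lt_prod (fun i _ => hxpos i) (fun i _ => hex i)
        ⟨j, Finset.mem_univ j, hj⟩).ne htot
    have hxi : x i = 0 := le_antisymm (hi ▸ hex i) (hx0 i)
    have hne : j ≠ i := by rintro rfl; linarith [hx0 j]
    have hxy' : ∀ l, x l ≤ Function.update (Function.update y j (x j)) i 0 l := by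
      intro l
      simp only [Function.update_apply]
      split_ifs with h1 h2
      · rw [h1, hxi]
      · rw [h2]
      · exact hex l
    refine le_trans ?_ (hG y j i (x j) 0 hy0 hne (hi ▸ hx0 j) hj.le (by simp [hi]) (fun _ => rfl))
    refine ih _ ?_ _ (fun l => (hx0 l).trans (hxy' l))
      (fun m => Finset.prod_le_prod (fun l _ => hx0 l) fun l _ => hxy' l) ?_ rfl
    · rw [← hN]
      apply Finset.card_lt_card
      rw [Finset.ssubset_iff_of_subset]
      · exact ⟨j, by simp [hj.ne], by simp [hne]⟩
      · intro l
        simp only [Finset.mem_filter, Finset.mem_univ, true_and, Function.update_apply]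
        intro h h'
        split_ifs at h with h1 h2
        · exact h (h1 ▸ hxi)
        · exact h (h2 ▸ rfl)
        · exact h h'
    · rw [prod_update_update hne y (by rw [hi, mul_zero, mul_zero]) (Finset.mem_univ _)
        (Finset.mem_univ _), htot]

lemma nonpos_of_prod_eq_of_neg {n : ℕ} {x y : Fin n → ℝ} (hx : ∀ i j : Fin n, i < j → |x j| ≤ x i)
    (hy : ∀ i j : Fin n, i < j → |y j| ≤ y i) (h : ∏ i, x i = ∏ i, y i) {i : Fin n}
    (hi : y i < 0) : x i ≤ 0 := by
  by_contra! hxi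
  have hlast : ∀ k, k ≠ i → k < i := fun k hk =>
    hk.lt_or_gt.resolve_right fun hlt => by linarith [hy i k hlt, abs_nonneg (y k)]
  have h₁ : 0 < ∏ k, x k := Finset.prod_pos fun k _ => by
    by_cases hki : k = i
    · rwa [hki]
    · exact (abs_pos.mpr hxi.ne').trans_le (hx k i (hlast k hki))
  have h₂ : 0 < ∏ k ∈ Finset.univ.erase i, y k := Finset.prod_pos fun k hk =>
    (abs_pos.mpr hi.ne).trans_le (hy k i (hlast k (Finset.ne_of_mem_erase hk)))
  rw [h, ← Finset.mul_prod_erase _ _ (Finset.mem_univ i)] at h₁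
  exact absurd h₁ (not_lt.mpr (mul_nonpos_of_nonpos_of_nonneg hi.le h₂.le))

lemma antitone_abs_of_abs_le {n : ℕ} {x : Fin n → ℝ} (hx : ∀ i j : Fin n, i < j → |x j| ≤ x i) :
    Antitone fun i => |x i| := by
  intro i j hij
  rcases hij.eq_or_lt with rfl | hlt
  · exact le_rfl
  · exact (hx i j hlt).trans (le_abs_self _)

lemma prod_abs_eq_of_lt {n : ℕ} {x : Fin n → ℝ} (hx : ∀ i j : Fin n, i < j → |x j| ≤ x i) {k : ℕ}
    (hk : k < n) : ∏ i ∈ Finset.univ.filter (fun i : Fin n => (i : ℕ) < k), |x i| =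
      ∏ i ∈ Finset.univ.filter (fun i : Fin n => (i : ℕ) < k), x i := by
  refine Finset.prod_congr rfl fun i hi => abs_of_nonneg ?_
  exact (abs_nonneg _).trans (hx i ⟨k, hk⟩ (by simpa [Fin.lt_def] using hi))

lemma IsSignedSVD.apply_eq {n : ℕ} {F : Matrix (Fin n) (Fin n) ℝ → ℝ} (hiso : Isotropic F)
    {A : Matrix (Fin n) (Fin n) ℝ} {lam : Fin n → ℝ} (hA : IsSignedSVD A lam) :
    F A = F (diagonal lam) := by
  obtain ⟨-, Q, R, hQ, hQd, hR, hRd, rfl⟩ := hA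
  exact hiso _ _ _ hQ hQd hR hRd

/-- **Monotonicity.** If `F` is continuous, rank-one convex and isotropic,
and the signed singular values of `A, B` satisfy `∏_{i≤k} λ_i(A) ≤ ∏_{i≤k} λ_i(B)` for
`k = 1,…,n-1` together with `∏ᵢ λ_i(A) = ∏ᵢ λ_i(B)`, then `F(A) ≤ F(B)`. -/
theorem stmt_4 {n : ℕ} (F : Matrix (Fin n) (Fin n) ℝ → ℝ)
    (hFc : Continuous F) (hrc : RankOneConvex F) (hiso : Isotropic F)
    (A B : Matrix (Fin n) (Fin n) ℝ) (lamA lamB : Fin n → ℝ)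
    (hA : IsSignedSVD A lamA) (hB : IsSignedSVD B lamB)
    (hk : ∀ k : ℕ, k < n →
      ∏ i ∈ Finset.univ.filter (fun i : Fin n => (i : ℕ) < k), lamA i ≤
      ∏ i ∈ Finset.univ.filter (fun i : Fin n => (i : ℕ) < k), lamB i)
    (hdet : ∏ i, lamA i = ∏ i, lamB i) :
    F A ≤ F B := by
  have hA' := hA.1
  have hB' := hB.1
  rw [hA.apply_eq hiso, hB.apply_eq hiso]
  let σ : Fin n → ℝ := fun i => if lamA i < 0 ∨ lamB i < 0 then -1 else 1
  have hσ : ∀ i, |σ i| = 1 := fun i => by simp only [σ]; split_ifs <;> simp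
  have hσ' : ∀ i, σ i * σ i = 1 := fun i => by simp only [σ]; split_ifs <;> simp
  have hσA : lamA = fun i => σ i * |lamA i| := by
    funext i
    simp only [σ]
    split_ifs with h
    · have : lamA i ≤ 0 := h.elim le_of_lt (nonpos_of_prod_eq_of_neg hA' hB' hdet)
      rw [abs_of_nonpos this]; ring
    · rw [abs_of_nonneg (by grind)]; ring
  have hσB : lamB = fun i => σ i * |lamB i| := by
    funext i
    simp only [σ]
    split_ifs with h
    · have : lamB i ≤ 0 := h.elim (nonpos_of_prod_eq_of_neg hB' hA' hdet.symm) le_of_lt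
      rw [abs_of_nonpos this]; ring
    · rw [abs_of_nonneg (by grind)]; ring
  have htot : ∏ i, |lamA i| = ∏ i, |lamB i| := by
    rw [← Finset.abs_prod, ← Finset.abs_prod, hdet]
  rw [hσA, hσB]
  refine le_of_log_majorized (fun z => F (diagonal fun i => σ i * z i)) ?_
    (fun i => |lamA i|) (fun i => abs_nonneg _) (antitone_abs_of_abs_le hA')
    (fun i => |lamB i|) (fun i => abs_nonneg _) ?_ htot
  · intro z i j a b hz hij h₁ h₂ h h0
    have ha : 0 ≤ a := (hz j).trans h₁
    have hupd : (fun l => σ l * Function.update (Function.update z i a) j b l) =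
        Function.update (Function.update (fun l => σ l * z l) i (σ i * a)) j (σ j * b) := by
      funext l
      simp only [Function.update_apply]
      split_ifs with h1 h2
      · rw [h1]
      · rw [h2]
      · rfl
    simp only [hupd]
    refine hrc.apply_diagonal_update_le hiso hij _ ?_ ?_ ?_ ?_
    · simpa [abs_mul, hσ, abs_of_nonneg (hz j), abs_of_nonneg ha] using h₁
    · simpa [abs_mul, hσ, abs_of_nonneg (hz i), abs_of_nonneg ha] using h₂
    · linear_combination σ i * σ j * h
    · intro h'
      have : a = 0 := by
        have := congrArg (σ i * ·) h'
        simpa [← mul_assoc, hσ'] using this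
      simp [h0 this]
  · intro k
    by_cases hkn : k < n
    · rw [prod_abs_eq_of_lt hA' hkn, prod_abs_eq_of_lt hB' hkn]
      exact hk k hkn
    · rw [Finset.filter_true_of_mem fun i _ => by omega]
      exact htot.le
end
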